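/- arXiv:1508.03866 — 2 statements merged into one kernel-verified Lean document; each statement's English description precedes it below -/
import Mathlib

section
/- Let n ≥ 4 and let G be a finite simple graph that is Ramsey for K_n. Then in every 2-colouring of the edges of G there is either a monochromatic copy of K_n + K_{n-1}, or both a monochromatic K_n in colour red and a monochromatic K_n in colour blue. -/
open Finset

/-- `S` is a monochromatic `K_m` in colour `b`: it has exactly `m` vertices,
its vertices are pairwise adjacent in `G`, and every edge inside `S` has colour `b`. -/
def IsMonoClique {V : Type*} (G : SimpleGraph V) (c : V → V → Bool) (b : Bool)
    (m : ℕ) (S : Finset V) : Prop :=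
  S.card = m ∧ (∀ x ∈ S, ∀ y ∈ S, x ≠ y → G.Adj x y) ∧
    (∀ x ∈ S, ∀ y ∈ S, x ≠ y → c x y = b)

/-- `G` is Ramsey for `K n`: every symmetric 2-colouring of the edges of `G`
contains a monochromatic `K n` in some colour. -/
def IsRamseyFor {V : Type*} (G : SimpleGraph V) (n : ℕ) : Prop :=
  ∀ c : V → V → Bool, (∀ x y, c x y = c y x) →
    ∃ b S, IsMonoClique G c b n S

/-- `G` is Ramsey for `K n + K m`: every symmetric 2-colouring of the edges of `G`
contains, in some colour `b`, two disjoint vertex sets that are a monochromatic `K n`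
and a monochromatic `K m` in colour `b`. -/
def IsRamseyForPair {V : Type*} (G : SimpleGraph V) (n m : ℕ) : Prop :=
  ∀ c : V → V → Bool, (∀ x y, c x y = c y x) →
    ∃ b S T, Disjoint S T ∧ IsMonoClique G c b n S ∧ IsMonoClique G c b m T

theorem IsMonoClique.subset {V : Type*} {G : SimpleGraph V} {c : V → V → Bool} {b : Bool}
    {m : ℕ} {S T : Finset V} (hS : IsMonoClique G c b m S) (hT : T ⊆ S) :
    IsMonoClique G c b T.card T :=
  ⟨rfl, fun x hx y hy => hS.2.1 x (hT hx) y (hT hy),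
    fun x hx y hy => hS.2.2 x (hT hx) y (hT hy)⟩

/-- Recolour the edges inside `B` with `!r`, the edges between `B` and `A` with `r` exactly when
they satisfy `R`, and the remaining edges leaving `B` with `r`. Under the stated conditions
no monochromatic `K n` survives. -/
theorem not_isRamseyFor_of_recolouring {V : Type*} {G : SimpleGraph V} {c : V → V → Bool}
    (hc : ∀ x y, c x y = c y x) {r : Bool} {n : ℕ} {A B : Finset V} (hAB : Disjoint A B)
    (R : V → V → Prop)
    (hother : ∀ S, ¬ IsMonoClique G c (!r) n S)
    (hcard : ∀ A' ⊆ A, ∀ B' ⊆ B, IsMonoClique G c (!r) A'.card A' →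
      (∀ a ∈ A', ∀ b ∈ B', ¬ R a b) → A'.card + B'.card < n)
    (hhit : ∀ S, IsMonoClique G c r n S → ¬ Disjoint S B)
    (hlink : ∀ b ∈ B, ∀ S, IsMonoClique G c r (n - 1) S →
      ¬ ∀ x ∈ S, x ∉ B ∧ (x ∈ A → R x b)) :
    ¬ IsRamseyFor G n := by
  classical
  intro hG
  let c' : V → V → Bool := fun x y =>
    if x ∈ B then
      if y ∈ B then !r else if y ∈ A then (if R y x then r else !r) else r
    else if y ∈ B then
      if x ∈ A then (if R x y then r else !r) else r
    else c x y
  have hBB : ∀ x ∈ B, ∀ y ∈ B, c' x y = !r := fun x hx y hy => by simp [c', hx, hy]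
  have hBA : ∀ x ∈ B, ∀ y ∈ A, c' y x = if R y x then r else !r := fun x hx y hy => by
    simp [c', hx, hy, Finset.disjoint_left.1 hAB hy]
  have hBO : ∀ x ∈ B, ∀ y ∉ B, y ∉ A → c' x y = r := fun x hx y hy hy' => by
    simp [c', hx, hy, hy']
  have hOO : ∀ x ∉ B, ∀ y ∉ B, c' x y = c x y := fun x hx y hy => by simp [c', hx, hy]
  have hsymm : ∀ x y, c' x y = c' y x := by
    intro x y
    by_cases hx : x ∈ B <;> by_cases hy : y ∈ B <;> simp [c', hx, hy, hc x y]
  obtain ⟨b, S, hS, hadj, hcol⟩ := hG c' hsymm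
  by_cases hb : b = r
  · subst hb
    by_cases hSB : Disjoint S B
    · refine hhit S ⟨hS, hadj, fun x hx y hy hxy => ?_⟩ hSB
      rw [← hOO x (Finset.disjoint_left.1 hSB hx) y (Finset.disjoint_left.1 hSB hy)]
      exact hcol x hx y hy hxy
    · obtain ⟨v, hvS, hvB⟩ := Finset.not_disjoint_iff.1 hSB
      have hout : ∀ x ∈ S.erase v, x ∉ B := fun x hx hxB => by
        have h := hcol x (Finset.mem_of_mem_erase hx) v hvS (Finset.ne_of_mem_erase hx)
        rw [hBB x hxB v hvB] at h
        simp at h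
      refine hlink v hvB (S.erase v) ⟨by rw [Finset.card_erase_of_mem hvS, hS], ?_, ?_⟩ ?_
      · exact fun x hx y hy => hadj x (Finset.mem_of_mem_erase hx) y (Finset.mem_of_mem_erase hy)
      · intro x hx y hy hxy
        rw [← hOO x (hout x hx) y (hout y hy)]
        exact hcol x (Finset.mem_of_mem_erase hx) y (Finset.mem_of_mem_erase hy) hxy
      · refine fun x hx => ⟨hout x hx, fun hxA => ?_⟩
        by_contra hR
        have h := hcol x (Finset.mem_of_mem_erase hx) v hvS (Finset.ne_of_mem_erase hx)
        rw [hBA v hvB x hxA] at h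
        simp [hR] at h
  · obtain rfl : b = !r := by cases b <;> cases r <;> simp_all
    by_cases hSB : Disjoint S B
    · refine hother S ⟨hS, hadj, fun x hx y hy hxy => ?_⟩
      rw [← hOO x (Finset.disjoint_left.1 hSB hx) y (Finset.disjoint_left.1 hSB hy)]
      exact hcol x hx y hy hxy
    · obtain ⟨v, hvS, hvB⟩ := Finset.not_disjoint_iff.1 hSB
      have hsub : ∀ x ∈ S, x ∉ B → x ∈ A := fun x hx hxB => by
        by_contra hxA
        have h := hcol v hvS x hx (fun h => hxB (h ▸ hvB))
        rw [hBO v hvB x hxB hxA] at h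
        simp at h
      have key := hcard (S \ B) (fun x hx => hsub x (by simp_all) (by simp_all)) (S ∩ B)
        Finset.inter_subset_right ⟨rfl, ?_, ?_⟩ ?_
      · rw [Finset.card_sdiff_add_card_inter, hS] at key
        exact lt_irrefl _ key
      · exact fun x hx y hy => hadj x (Finset.mem_sdiff.1 hx).1 y (Finset.mem_sdiff.1 hy).1
      · intro x hx y hy hxy
        rw [Finset.mem_sdiff] at hx hy
        rw [← hOO x hx.2 y hy.2]
        exact hcol x hx.1 y hy.1 hxy
      · intro x hx y hy hR
        rw [Finset.mem_sdiff] at hx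
        rw [Finset.mem_inter] at hy
        have h := hcol x hx.1 y hy.1 (fun h => hx.2 (h ▸ hy.2))
        rw [hBA y hy.2 x (hsub x hx.1 hx.2)] at h
        simp [hR] at h

theorem not_isRamseyFor_of_unique {V : Type*} {G : SimpleGraph V} {c : V → V → Bool}
    (hc : ∀ x y, c x y = c y x) {r : Bool} {n : ℕ} (hn : 3 ≤ n)
    (hother : ∀ S, ¬ IsMonoClique G c (!r) n S)
    (hpair : ∀ S T, IsMonoClique G c r n S → IsMonoClique G c r (n - 1) T → ¬ Disjoint S T)
    {S : Finset V} (hS : IsMonoClique G c r n S)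
    (huniq : ∀ X, IsMonoClique G c r n X → X = S) : ¬ IsRamseyFor G n := by
  classical
  obtain ⟨A, hAS, hA⟩ := Finset.exists_subset_card_eq (s := S) (n := 2) (by rw [hS.1]; omega)
  have hB : (S \ A).card = n - 2 := by rw [Finset.card_sdiff_of_subset hAS, hA, hS.1]
  refine not_isRamseyFor_of_recolouring hc (A := A) (B := S \ A) Finset.disjoint_sdiff
    (fun _ _ => False) hother ?_ ?_ ?_
  · intro A' hA' B' hB' hmono _
    have hA'card : A'.card ≤ 1 := by
      refine Finset.card_le_one.2 fun x hx y hy => ?_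
      by_contra hxy
      have h := hS.2.2 x (hAS (hA' hx)) y (hAS (hA' hy)) hxy
      rw [hmono.2.2 x hx y hy hxy] at h
      simp at h
    have := Finset.card_le_card hB'
    omega
  · intro X hX hdisj
    rw [huniq X hX] at hdisj
    have hempty := Finset.disjoint_self_iff_empty _ |>.1
      (Finset.disjoint_of_subset_left Finset.sdiff_subset hdisj)
    rw [hempty, Finset.card_empty] at hB
    omega
  · intro b _ T hT h
    refine hpair S T hS hT (Finset.disjoint_right.2 fun x hx hxS => ?_)
    have := h x hx
    simp_all

theorem not_isRamseyFor_of_ne {V : Type*} {G : SimpleGraph V} {c : V → V → Bool}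
    (hc : ∀ x y, c x y = c y x) {r : Bool} {n : ℕ} (hn : 2 ≤ n)
    (hother : ∀ S, ¬ IsMonoClique G c (!r) n S)
    (hpair : ∀ S T, IsMonoClique G c r n S → IsMonoClique G c r (n - 1) T → ¬ Disjoint S T)
    {S X : Finset V} (hS : IsMonoClique G c r n S) (hX : IsMonoClique G c r n X)
    (hne : X ≠ S) : ¬ IsRamseyFor G n := by
  classical
  obtain ⟨v, hvS, hvX⟩ : ∃ v ∈ S, v ∉ X := by
    by_contra! h
    exact hne (Finset.eq_of_subset_of_card_le h (by rw [hS.1, hX.1])).symm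
  have hdiff : (X \ S).card < n - 1 := by
    by_contra! h
    obtain ⟨T, hTX, hT⟩ := Finset.exists_subset_card_eq h
    refine hpair S T hS (hT ▸ hX.subset (hTX.trans Finset.sdiff_subset)) ?_
    exact Finset.disjoint_of_subset_right hTX Finset.disjoint_sdiff
  have hBcard : (S.erase v).card = n - 1 := by rw [Finset.card_erase_of_mem hvS, hS.1]
  have hAcard : (insert v (X \ S)).card ≤ (S.erase v).card := by
    have := Finset.card_insert_le v (X \ S)
    omega
  have : Nonempty V := ⟨v⟩
  obtain ⟨f, hf, hinj⟩ := Set.Finite.exists_injOn_of_encard_le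
    (Finset.finite_toSet (insert v (X \ S))) (t := ((S.erase v : Finset V) : Set V))
    (by rw [Set.encard_coe_eq_coe_finsetCard, Set.encard_coe_eq_coe_finsetCard]
        exact_mod_cast hAcard)
  refine not_isRamseyFor_of_recolouring hc (A := insert v (X \ S)) (B := S.erase v) ?_
    (fun a b => f a = b) hother ?_ ?_ ?_
  · rw [Finset.disjoint_left]
    simp +contextual
  · intro A' hA' B' hB' _ hR
    have hdisj : Disjoint (A'.image f) B' := by
      rw [Finset.disjoint_left]
      intro y hy hyB
      obtain ⟨a, ha, rfl⟩ := Finset.mem_image.1 hy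
      exact hR a ha _ hyB rfl
    have hsub : A'.image f ∪ B' ⊆ S.erase v :=
      Finset.union_subset (Finset.image_subset_iff.2 fun a ha => hf (hA' ha)) hB'
    have hle := Finset.card_le_card hsub
    rw [Finset.card_union_of_disjoint hdisj,
      Finset.card_image_of_injOn (hinj.mono (Finset.coe_subset.2 hA')), hBcard] at hle
    omega
  · intro K hK hdisj
    obtain ⟨T, hTK, hT⟩ := Finset.exists_subset_card_eq (s := K.erase v) (n := n - 1)
      (by have := Finset.pred_card_le_card_erase (s := K) (a := v); rwa [hK.1] at this)
    refine hpair S T hS (hT ▸ hK.subset (hTK.trans (Finset.erase_subset _ _)))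
      (Finset.disjoint_right.2 fun x hx hxS => ?_)
    have hxv := Finset.mem_erase.1 (hTK hx)
    exact Finset.disjoint_left.1 hdisj hxv.2 (Finset.mem_erase.2 ⟨hxv.1, hxS⟩)
  · intro b _ T hT h
    by_cases hvT : v ∈ T
    · refine hpair X T hX hT (Finset.disjoint_right.2 fun x hx hxX => ?_)
      have hxv : x ≠ v := fun h => hvX (h ▸ hxX)
      have hxS : x ∉ S := fun hxS => (h x hx).1 (Finset.mem_erase.2 ⟨hxv, hxS⟩)
      have hxA : x ∈ insert v (X \ S) := by simp [hxX, hxS]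
      have hvA : v ∈ insert v (X \ S) := by simp
      exact hxv (hinj hxA hvA (((h x hx).2 hxA).trans ((h v hvT).2 hvA).symm))
    · refine hpair S T hS hT (Finset.disjoint_right.2 fun x hx hxS => ?_)
      exact (h x hx).1 (Finset.mem_erase.2 ⟨fun h => hvT (h ▸ hx), hxS⟩)

theorem mono_pair_or_red_and_blue_Kn (n : ℕ) (hn : 4 ≤ n)
    {α : Type*} [Fintype α] (G : SimpleGraph α) (hG : IsRamseyFor G n)
    (c : α → α → Bool) (hc : ∀ u v, c u v = c v u) :
    (∃ b S T, Disjoint S T ∧ IsMonoClique G c b n S ∧ IsMonoClique G c b (n - 1) T) ∨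
      ((∃ S, IsMonoClique G c true n S) ∧ (∃ T, IsMonoClique G c false n T)) := by
  refine or_iff_not_imp_left.2 fun hno => ?_
  obtain ⟨r, S, hS⟩ := hG c hc
  have hpair : ∀ S T, IsMonoClique G c r n S → IsMonoClique G c r (n - 1) T → ¬ Disjoint S T :=
    fun S T hS hT hd => hno ⟨r, S, T, hd, hS, hT⟩
  have hother : ∃ T, IsMonoClique G c (!r) n T := by
    by_contra! hother
    by_cases huniq : ∀ X, IsMonoClique G c r n X → X = S
    · exact not_isRamseyFor_of_unique hc (by omega) hother hpair hS huniq hG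
    · push Not at huniq
      obtain ⟨X, hX, hne⟩ := huniq
      exact not_isRamseyFor_of_ne hc (by omega) hother hpair hS hX hne hG
  cases r
  · exact ⟨hother, S, hS⟩
  · exact ⟨⟨S, hS⟩, hother⟩
end

section
/- Let n ≥ 4 and let G be a finite simple graph that is Ramsey for K_n. Then in any 2-colouring of the edges of G, if there is a monochromatic K_{n+1} (in some colour), then there is a monochromatic copy of K_n + K_{n-1} (in some colour). -/
open Finset

/-- The roles played by vertices in the recolouring: `core` vertices and `hub` vertices mostly keep
their colours, while `wing b` vertices send edges of colour `b` to the core and span edges of the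
opposite colour. -/
inductive Role (ι : Type*)
  | core
  | hub (i : ι)
  | wing (b : Bool) (i : ι)

namespace Role

variable {k : ℕ}

/-- The new colour of an edge of old colour `o`, in terms of the roles of its end points. -/
def colour (b₀ o : Bool) : Role (Fin (k + 3)) → Role (Fin (k + 3)) → Bool
  | core, core => o
  | core, hub _ => o
  | hub _, core => o
  | hub i, hub j => if (i.val = 1 ↔ j.val = 1) then !b₀ else b₀
  | core, wing b _ => b
  | wing b _, core => b
  | hub i, wing b j => if i = j then b else !b
  | wing b j, hub i => if i = j then b else !b
  | wing true i, wing false j => decide (j ≠ i + 1)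
  | wing false j, wing true i => decide (j ≠ i + 1)
  | wing true _, wing true _ => false
  | wing false _, wing false _ => true

theorem colour_comm (b₀ o : Bool) (r s : Role (Fin (k + 3))) :
    colour b₀ o r s = colour b₀ o s r := by
  rcases r with _ | i | ⟨_ | _, i⟩ <;> rcases s with _ | j | ⟨_ | _, j⟩ <;>
    simp [colour, iff_comm]

theorem colour_wing_wing (b₀ o b : Bool) (i j : Fin (k + 3)) :
    colour b₀ o (wing b i) (wing b j) = !b := by
  cases b <;> rfl

/-- The recolouring of `c` determined by an assignment of roles. -/
def recolour {α : Type*} (b₀ : Bool) (c : α → α → Bool) (lab : α → Role (Fin (k + 3)))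
    (x y : α) : Bool :=
  colour b₀ (c x y) (lab x) (lab y)

/-- The index of a role, shifted cyclically on the wing of colour `b`. -/
def index (b : Bool) : Role (Fin (k + 3)) → Fin (k + 3)
  | core => 0
  | hub i => i
  | wing b' i => if b' = b then i + 1 else i

theorem add_one_ne (i : Fin (k + 3)) : i + 1 ≠ i := by
  simp

theorem add_one_add_one_ne (i : Fin (k + 3)) : i + 1 + 1 ≠ i := by
  rw [add_assoc, Ne, add_eq_left]
  intro h
  have := congrArg Fin.val h
  rw [Fin.val_add, Fin.val_one, Fin.val_zero, Nat.mod_eq_of_lt (by omega)] at this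
  omega

theorem index_ne {b₀ o b : Bool} {r s : Role (Fin (k + 3))} (hr : r ≠ core) (hs : s ≠ core)
    (hrs : r ≠ s) (h : colour b₀ o r s = b) : index b r ≠ index b s := by
  have h1 := add_one_ne (k := k)
  have h2 := add_one_add_one_ne (k := k)
  rcases r with _ | i | ⟨_ | _, i⟩ <;> rcases s with _ | j | ⟨_ | _, j⟩ <;> cases b <;>
    simp_all [colour, index] <;> grind

variable {α : Type*} {G : SimpleGraph α} {c : α → α → Bool} {b₀ b : Bool}
  {lab : α → Role (Fin (k + 3))} {m : ℕ} {K : Finset α}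

theorem card_le_of_forall_ne_core (hinj : ∀ x y, lab x ≠ core → lab x = lab y → x = y)
    (hK : IsMonoClique G (recolour b₀ c lab) b m K) (hcore : ∀ x ∈ K, lab x ≠ core) :
    m ≤ k + 3 := by
  rw [← hK.1, ← Fintype.card_fin (k + 3), ← Finset.card_univ]
  refine Finset.card_le_card_of_injOn (fun x => index b (lab x)) (by simp) ?_
  intro x hx y hy hxy
  by_contra hne
  exact index_ne (hcore x hx) (hcore y hy) (fun h => hne (hinj x y (hcore x hx) h))
    (hK.2.2 x hx y hy hne) hxy

/-- A set of core vertices together with at most one hub. -/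
def IsCoreSet (lab : α → Role (Fin (k + 3))) (D : Finset α) : Prop :=
  (∀ x ∈ D, ∀ b i, lab x ≠ wing b i) ∧
    ∀ x ∈ D, ∀ y ∈ D, lab x ≠ core → lab y ≠ core → x = y

theorem IsCoreSet.isMonoClique {D : Finset α} (hD : IsCoreSet lab D)
    (h : IsMonoClique G (recolour b₀ c lab) b m D) : IsMonoClique G c b m D := by
  refine ⟨h.1, h.2.1, fun x hx y hy hxy => ?_⟩
  have h1 := h.2.2 x hx y hy hxy
  have h2 := hD.1 x hx
  have h3 := hD.1 y hy
  have h4 := hD.2 x hx y hy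
  unfold recolour at h1
  rcases hlx : lab x with _ | i | ⟨b, i⟩ <;> rcases hly : lab y with _ | j | ⟨b, j⟩ <;>
    simp_all [colour]

theorem card_le_of_isCoreSet (hinj : ∀ x y, lab x ≠ core → lab x = lab y → x = y)
    (hhub : ∀ x i, lab x = hub i → i.val < 3)
    (hD : ∀ D, IsCoreSet lab D → ¬ IsMonoClique G c b (k + 3) D)
    (hK : IsMonoClique G (recolour b₀ c lab) b m K) : m ≤ k + 3 := by
  classical
  by_cases hcore : ∀ x ∈ K, lab x ≠ core
  · exact card_le_of_forall_ne_core hinj hK hcore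
  push Not at hcore
  obtain ⟨w, hw, hwc⟩ := hcore
  have small : ∀ D ⊆ K, IsCoreSet lab D → D.card ≤ k + 2 := by
    intro D hDK hDc
    by_contra! hlt
    obtain ⟨E, hE, hEc⟩ := Finset.exists_subset_card_eq (show k + 3 ≤ D.card from hlt)
    have hEs : IsCoreSet lab E :=
      ⟨fun x hx => hDc.1 x (hE hx), fun x hx y hy => hDc.2 x (hE hx) y (hE hy)⟩
    exact hD E hEs (hEc ▸ hEs.isMonoClique (hK.subset (hE.trans hDK)))
  have wing_eq : ∀ x ∈ K, ∀ b' i, lab x = wing b' i → b' = b := by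
    intro x hx b' i hxi
    have hwx : w ≠ x := by rintro rfl; simp [hwc] at hxi
    have := hK.2.2 w hw x hx hwx
    simpa [recolour, hwc, hxi, colour] using this
  have wing_unique : ∀ x ∈ K, ∀ y ∈ K, ∀ i j, lab x = wing b i → lab y = wing b j → x = y := by
    intro x hx y hy i j hi hj
    by_contra hne
    have := hK.2.2 x hx y hy hne
    simp [recolour, hi, hj, colour_wing_wing] at this
  have hub_wing : ∀ x ∈ K, ∀ y ∈ K, ∀ i j, lab x = hub i → lab y = wing b j → i = j := by
    intro x hx y hy i j hi hj
    have hne : x ≠ y := by rintro rfl; simp [hi] at hj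
    have := hK.2.2 x hx y hy hne
    by_contra hij
    simp [recolour, hi, hj, colour, hij] at this
  have hub_hub : ∀ x ∈ K, ∀ y ∈ K, ∀ i j, lab x = hub i → lab y = hub j → x ≠ y →
      i ≠ j ∧ (if (i.val = 1 ↔ j.val = 1) then !b₀ else b₀) = b := by
    intro x hx y hy i j hi hj hne
    refine ⟨fun hij => hne (hinj x y (by simp [hi]) (by rw [hi, hj, hij])), ?_⟩
    simpa [recolour, hi, hj, colour] using hK.2.2 x hx y hy hne
  set C := K.filter (fun x => lab x = core) with hC
  set T := K.filter (fun x => lab x ≠ core) with hT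
  have hsum : C.card + T.card = m := by
    rw [← hK.1]; exact Finset.card_filter_add_card_filter_not _
  have hCc : C.card ≤ k + 2 :=
    small C (Finset.filter_subset _ _) ⟨by simp +contextual [hC], by simp +contextual [hC]⟩
  have hT2 : T.card ≤ 2 := by
    by_contra! hlt
    obtain ⟨x, y, z, hx, hy, hz, hxy, hxz, hyz⟩ := Finset.two_lt_card_iff.1 hlt
    simp only [hT, Finset.mem_filter] at hx hy hz
    have roles : ∀ x ∈ K, lab x ≠ core → (∃ i, lab x = hub i) ∨ ∃ i, lab x = wing b i := by
      intro x hx hxc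
      rcases h : lab x with _ | i | ⟨b', i⟩
      · exact absurd h hxc
      · exact Or.inl ⟨i, rfl⟩
      · exact Or.inr ⟨i, by rw [wing_eq x hx b' i h]⟩
    have two_hubs : ∀ x ∈ K, ∀ y ∈ K, ∀ z ∈ K, ∀ i j l, lab x = hub i → lab y = hub j →
        lab z = wing b l → x ≠ y → False := by
      intro x hx y hy z hz i j l hi hj hl hne
      exact (hub_hub x hx y hy i j hi hj hne).1
        ((hub_wing x hx z hz i l hi hl).trans (hub_wing y hy z hz j l hj hl).symm)
    rcases roles x hx.1 hx.2 with ⟨i, hi⟩ | ⟨i, hi⟩ <;>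
    rcases roles y hy.1 hy.2 with ⟨j, hj⟩ | ⟨j, hj⟩ <;>
    rcases roles z hz.1 hz.2 with ⟨l, hl⟩ | ⟨l, hl⟩
    · obtain ⟨h1, k1⟩ := hub_hub x hx.1 y hy.1 i j hi hj hxy
      obtain ⟨h2, k2⟩ := hub_hub x hx.1 z hz.1 i l hi hl hxz
      obtain ⟨h3, k3⟩ := hub_hub y hy.1 z hz.1 j l hj hl hyz
      have := hhub x i hi
      have := hhub y j hj
      have := hhub z l hl
      rw [Ne, Fin.ext_iff] at h1 h2 h3
      cases b <;> cases b₀ <;> simp at k1 k2 k3 <;> omega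
    · exact two_hubs x hx.1 y hy.1 z hz.1 i j l hi hj hl hxy
    · exact two_hubs x hx.1 z hz.1 y hy.1 i l j hi hl hj hxz
    · exact hyz (wing_unique y hy.1 z hz.1 j l hj hl)
    · exact two_hubs y hy.1 z hz.1 x hx.1 j l i hj hl hi hyz
    · exact hxz (wing_unique x hx.1 z hz.1 i l hi hl)
    · exact hxy (wing_unique x hx.1 y hy.1 i j hi hj)
    · exact hxy (wing_unique x hx.1 y hy.1 i j hi hj)
  by_cases hT1 : T.card ≤ 1
  · omega
  have hex : ∃ x ∈ K, ∃ i, lab x = hub i := by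
    by_contra! hno
    refine hT1 (Finset.card_le_one.2 fun x hx y hy => ?_)
    simp only [hT, Finset.mem_filter] at hx hy
    rcases hlx : lab x with _ | i | ⟨b', i⟩
    · exact absurd hlx hx.2
    · exact absurd hlx (hno x hx.1 i)
    rcases hly : lab y with _ | j | ⟨b'', j⟩
    · exact absurd hly hy.2
    · exact absurd hly (hno y hy.1 j)
    obtain rfl := wing_eq x hx.1 _ _ hlx
    obtain rfl := wing_eq y hy.1 _ _ hly
    exact wing_unique x hx.1 y hy.1 i j hlx hly
  obtain ⟨x, hx, i, hi⟩ := hex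
  have hxC : x ∉ C := by simp [hC, hi]
  have := small (insert x C) (Finset.insert_subset hx (Finset.filter_subset _ _))
    ⟨by simp +contextual [hC, hi], by simp +contextual [hC, hi]⟩
  rw [Finset.card_insert_of_notMem hxC] at this
  omega

end Role

theorem exists_injOn_of_card_le {α β : Type*} [Fintype β] [Nonempty β] (Q : Finset α)
    (h : Q.card ≤ Fintype.card β) : ∃ f : α → β, Set.InjOn f Q := by
  classical
  obtain ⟨e⟩ := Function.Embedding.nonempty_of_card_le (α := Q) (β := β) (by simpa using h)
  refine ⟨fun x => if hx : x ∈ Q then e ⟨x, hx⟩ else Classical.arbitrary β, ?_⟩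
  intro x hx y hy hxy
  have hx' : x ∈ Q := hx
  have hy' : y ∈ Q := hy
  simpa [hx', hy'] using hxy

open Role

/-- A set `Q` of at most `t ≤ 3` vertices can be made the hubs, and the rest of `P` the wings. -/
theorem Role.exists_lab {α : Type*} {k t : ℕ} (htpos : 0 < t) (ht : t ≤ 3) {Q P : Finset α}
    (hQ : Q.card ≤ t)
    (g : α → Bool × Fin (k + 3)) (hg : Set.InjOn g P) :
    ∃ lab : α → Role (Fin (k + 3)),
      (∀ x y, lab x ≠ core → lab x = lab y → x = y) ∧
      (∀ x, lab x = core ↔ x ∉ Q ∧ x ∉ P) ∧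
      (∀ x i, lab x = hub i → x ∈ Q ∧ i.val < t) ∧
      (∀ x b i, lab x = wing b i → b = (g x).1) := by
  classical
  have : Nonempty (Fin t) := ⟨⟨0, htpos⟩⟩
  obtain ⟨f, hf⟩ := exists_injOn_of_card_le (β := Fin t) Q (by simpa using hQ)
  have hle : t ≤ k + 3 := by omega
  refine ⟨fun x => if x ∈ Q then hub (Fin.castLE hle (f x)) else
    if x ∈ P then wing (g x).1 (g x).2 else core, ?_, ?_, ?_, ?_⟩
  · intro x y hx hxy
    by_cases hxQ : x ∈ Q <;> by_cases hyQ : y ∈ Q <;> by_cases hxP : x ∈ P <;>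
      by_cases hyP : y ∈ P <;> simp [hxP, hyP, hxQ, hyQ] at hx hxy
    any_goals exact hf hxQ hyQ hxy
    exact hg hxP hyP (Prod.ext hxy.1 hxy.2)
  · intro x
    by_cases hxQ : x ∈ Q <;> by_cases hxP : x ∈ P <;> simp [hxQ, hxP]
  · intro x i hi
    by_cases hxQ : x ∈ Q <;> by_cases hxP : x ∈ P <;> simp [hxQ, hxP] at hi
    all_goals
      subst hi
      exact ⟨hxQ, (f x).isLt⟩
  · intro x b i hi
    by_cases hxQ : x ∈ Q <;> by_cases hxP : x ∈ P <;> simp [hxQ, hxP] at hi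
    exact hi.1.symm

theorem mono_pair_of_mono_Knsucc (n : ℕ) (hn : 4 ≤ n)
    {α : Type*} [Fintype α] (G : SimpleGraph α) (hG : IsRamseyFor G n)
    (c : α → α → Bool) (hc : ∀ u v, c u v = c v u)
    (h : ∃ b S, IsMonoClique G c b (n + 1) S) :
    ∃ b S T, Disjoint S T ∧ IsMonoClique G c b n S ∧ IsMonoClique G c b (n - 1) T := by
  classical
  obtain ⟨k, rfl⟩ : ∃ k, n = k + 4 := ⟨n - 4, by omega⟩
  rw [show k + 4 - 1 = k + 3 from rfl]
  by_contra! hno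
  obtain ⟨b₀, S, hS⟩ := h
  have ramsey : ∀ lab : α → Role (Fin (k + 3)),
      (∀ b K, IsMonoClique G (recolour b₀ c lab) b (k + 4) K → k + 4 ≤ k + 3) → False := by
    intro lab hlab
    obtain ⟨b, K, hK⟩ := hG (recolour b₀ c lab) fun x y => by
      rw [recolour, recolour, hc x y, colour_comm]
    have := hlab b K hK
    omega
  have meets : ∀ D x, (∀ y ∈ D, y ∈ S → y = x) → ¬ IsMonoClique G c b₀ (k + 3) D := by
    intro D x hD hDc
    have hcard : k + 4 ≤ (S.erase x).card := by
      have := Finset.pred_card_le_card_erase (s := S) (a := x)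
      have := hS.1
      omega
    obtain ⟨A, hA, hAc⟩ := Finset.exists_subset_card_eq hcard
    refine hno b₀ A D ?_ (hAc ▸ hS.subset (hA.trans (Finset.erase_subset _ _))) hDc
    rw [Finset.disjoint_left]
    intro y hyA hyD
    have := Finset.mem_erase.1 (hA hyA)
    exact this.1 (hD y hyD this.2)
  have core_meets : ∀ (lab : α → Role (Fin (k + 3))), (∀ y ∈ S, lab y ≠ core) →
      ∀ D, IsCoreSet lab D → ¬ IsMonoClique G c b₀ (k + 3) D := by
    intro lab hlab D hD hDc
    obtain ⟨z, -⟩ : D.Nonempty := by rw [← Finset.card_pos, hDc.1]; omega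
    by_cases hex : ∃ x ∈ D, x ∈ S
    · obtain ⟨x, hx, hxS⟩ := hex
      exact meets D x (fun y hy hyS => hD.2 y hy x hx (hlab y hyS) (hlab x hxS)) hDc
    · push Not at hex
      exact meets D z (fun y hy hyS => absurd hyS (hex y hy)) hDc
  by_cases hB : ∃ B, IsMonoClique G c (!b₀) (k + 4) B
  · obtain ⟨B, hB⟩ := hB
    have hSB : (S ∩ B).card ≤ 1 := by
      refine Finset.card_le_one.2 fun x hx y hy => ?_
      rw [Finset.mem_inter] at hx hy
      by_contra hne
      have h1 := hS.2.2 x hx.1 y hy.1 hne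
      have h2 := hB.2.2 x hx.2 y hy.2 hne
      cases b₀ <;> simp_all
    have hdiff : 3 ≤ (S \ B).card := by
      have := Finset.card_sdiff_add_card_inter S B
      have := hS.1
      omega
    obtain ⟨Q, hQ, hQc⟩ := Finset.exists_subset_card_eq hdiff
    have hQSB : Q ⊆ S ∪ B := hQ.trans (Finset.sdiff_subset.trans Finset.subset_union_left)
    have hPc : ((S ∪ B) \ Q).card ≤ Fintype.card (Bool × Fin (k + 3)) := by
      have h1 := Finset.card_union_le S B
      have h2 := Finset.card_sdiff_add_card_eq_card hQSB
      have h3 := hS.1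
      have h4 := hB.1
      simp only [Fintype.card_prod, Fintype.card_bool, Fintype.card_fin]
      omega
    obtain ⟨g, hg⟩ := exists_injOn_of_card_le _ hPc
    obtain ⟨lab, hinj, hcore, hhub, -⟩ :=
      Role.exists_lab (by norm_num) le_rfl hQc.le g hg
    refine ramsey lab fun b K hK =>
      card_le_of_isCoreSet hinj (fun x i hi => (hhub x i hi).2) ?_ hK
    rcases Bool.eq_or_eq_not b b₀ with rfl | rfl
    · exact core_meets lab fun y hy hyc => by
        have := (hcore y).1 hyc
        simp_all
    · intro D hD hDc
      refine hno _ B D (Finset.disjoint_left.2 fun y hyB hyD => ?_) hB hDc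
      rcases hly : lab y with _ | i | ⟨b, i⟩
      · have := (hcore y).1 hly
        simp_all
      · exact (Finset.mem_sdiff.1 (hQ (hhub y i hly).1)).2 hyB
      · exact hD.1 y hyD b i hly
  · push Not at hB
    obtain ⟨Q, hQ, hQc⟩ := Finset.exists_subset_card_eq (show 2 ≤ S.card by rw [hS.1]; omega)
    have hPc : (S \ Q).card ≤ Fintype.card (Fin (k + 3)) := by
      have h2 := Finset.card_sdiff_add_card_eq_card hQ
      have h3 := hS.1
      rw [Fintype.card_fin]
      omega
    obtain ⟨g, hg⟩ := exists_injOn_of_card_le _ hPc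
    obtain ⟨lab, hinj, hcore, hhub, hwing⟩ :=
      Role.exists_lab two_pos (by norm_num) hQc.le (fun x => (b₀, g x))
        (fun x hx y hy hxy => hg hx hy (Prod.ext_iff.1 hxy).2)
    refine ramsey lab fun b K hK => ?_
    rcases Bool.eq_or_eq_not b b₀ with rfl | rfl
    · refine card_le_of_isCoreSet hinj (fun x i hi => (hhub x i hi).2.trans (by norm_num))
        (core_meets lab fun y hy hyc => ?_) hK
      have := (hcore y).1 hyc
      simp_all
    by_cases hKc : ∀ x ∈ K, lab x ≠ core
    · exact card_le_of_forall_ne_core hinj hK hKc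
    push Not at hKc
    obtain ⟨w, hw, hwc⟩ := hKc
    have no_wing : ∀ x ∈ K, ∀ b i, lab x ≠ wing b i := by
      intro x hx b i hxi
      have hb : b = b₀ := hwing x b i hxi
      have hwx : w ≠ x := by rintro rfl; simp [hwc] at hxi
      have := hK.2.2 w hw x hx hwx
      simp [recolour, hwc, hxi, colour, hb] at this
    refine absurd (IsCoreSet.isMonoClique ⟨no_wing, fun x hx y hy hxc hyc => ?_⟩ hK) (hB K)
    rcases hlx : lab x with _ | i | ⟨b, i⟩
    · exact absurd hlx hxc
    · rcases hly : lab y with _ | j | ⟨b, j⟩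
      · exact absurd hly hyc
      · by_contra hne
        have hij : i ≠ j := fun hij => hne (hinj x y hxc (by rw [hlx, hly, hij]))
        have h1 := (hhub x i hlx).2
        have h2 := (hhub y j hly).2
        have h3 := hK.2.2 x hx y hy hne
        rw [Ne, Fin.ext_iff] at hij
        have h4 : ¬ (i.val = 1 ↔ j.val = 1) := by omega
        simp [recolour, hlx, hly, colour, h4] at h3
      · exact absurd hly (no_wing y hy b j)
    · exact absurd hlx (no_wing x hx b i)
end
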